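/- arXiv:1911.06757 — 2 statements merged into one kernel-verified Lean document; each statement's English description precedes it below -/
import Mathlib

section
/- Let M = (G, H, (v_i)) be a graphical matching problem instance with uniform valuation such that: (i) the player graph G is a directed cycle on N = {1,...,n} (τ = {(i, i+1) : 1 ≤ i ≤ n−1} ∪ {(n,1)}) and there exist players i, j with (j,i) ∈ τ and w_{j,i} > 0; and (ii) there is an item a ∈ A that is adjacent in H to every other item. Then M admits a 2-stable allocation. -/
open scoped Classical

/-- A graphical matching problem instance: a player graph `(tau, w)` on players `N`
(no self-loops), an item graph `lam` on items `A` (symmetric, irreflexive), and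
nonnegative valuations `v`. -/
structure GMP (N A : Type*) [Fintype N] [Fintype A] where
  tau : N → N → Prop
  w : N → N → ℝ
  noSelf : ∀ i, ¬ tau i i
  lam : A → A → Prop
  lamSymm : ∀ a b, lam a b → lam b a
  lamIrrefl : ∀ a, ¬ lam a a
  v : N → A → ℝ
  vNonneg : ∀ i a, 0 ≤ v i a

variable {N A : Type*} [Fintype N] [Fintype A]

/-- The utility of player `i` under allocation `π`. -/
noncomputable def GMP.utility (M : GMP N A) (π : N ≃ A) (i : N) : ℝ :=
  M.v i (π i) +
    ∑ j ∈ Finset.univ.filter (fun j => M.tau j i ∧ M.lam (π j) (π i)), M.w j i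

/-- The allocation obtained from `π` by swapping the items of `i` and `j`. -/
noncomputable def swapAlloc (π : N ≃ A) (i j : N) : N ≃ A := (Equiv.swap i j).trans π

/-- `(i, j)` is a blocking pair in `π`. -/
def GMP.BlockingPair (M : GMP N A) (π : N ≃ A) (i j : N) : Prop :=
  i ≠ j ∧ M.utility π i < M.utility (swapAlloc π i j) i ∧
    M.utility π j < M.utility (swapAlloc π i j) j

/-- An allocation is 2-stable if it has no blocking pair. -/
def GMP.TwoStable (M : GMP N A) (π : N ≃ A) : Prop :=
  ∀ i j, ¬ M.BlockingPair π i j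

/-- The player graph is symmetric. -/
def GMP.Symm (M : GMP N A) : Prop :=
  ∀ i j, M.tau i j → M.tau j i ∧ M.w i j = M.w j i

/-- The potential function `φ(π) = Σ_i (v_i(π(i)) + u_i(π))`. -/
noncomputable def GMP.phi (M : GMP N A) (π : N ≃ A) : ℝ :=
  ∑ i, (M.v i (π i) + M.utility π i)

/-- Social welfare. -/
noncomputable def GMP.SW (M : GMP N A) (π : N ≃ A) : ℝ :=
  ∑ i, M.utility π i

/-- `X` is a blocking coalition in `π` witnessed by `π'`. -/
def GMP.BlocksVia (M : GMP N A) (π : N ≃ A) (X : Finset N) (π' : N ≃ A) : Prop :=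
  X.Nonempty ∧ ∃ μ : N → N, Set.BijOn μ ↑X ↑X ∧
    (∀ k, k ∉ X → π' k = π k) ∧
    ∀ i ∈ X, π' i = π (μ i) ∧ π' i ≠ π i ∧ M.utility π i < M.utility π' i

/-- `X` is a blocking coalition in `π`. -/
def GMP.BlockingCoalition (M : GMP N A) (π : N ≃ A) (X : Finset N) : Prop :=
  ∃ π' : N ≃ A, M.BlocksVia π X π'

/-- An allocation is core stable if it has no blocking coalition. -/
def GMP.CoreStable (M : GMP N A) (π : N ≃ A) : Prop :=
  ∀ X : Finset N, ¬ M.BlockingCoalition π X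

/-- An allocation is envy-free if no player strictly gains from a (unilateral) swap. -/
def GMP.EnvyFree (M : GMP N A) (π : N ≃ A) : Prop :=
  ∀ i j, ¬ M.utility π i < M.utility (swapAlloc π i j) i

theorem GMP.utility_congr (M : GMP N A) {π π' : N ≃ A} {i : N}
    (hval : M.v i (π' i) = M.v i (π i)) (hi : π' i = π i)
    (h : ∀ j, M.tau j i → π' j = π j) : M.utility π' i = M.utility π i := by
  unfold GMP.utility
  rw [hval]
  congr 1
  refine Finset.sum_congr (Finset.filter_congr fun j _ => ?_) fun _ _ => rfl
  refine and_congr_right fun hj => ?_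
  rw [h j hj, hi]

/-- A player holding an item adjacent to all others is adjacent to all its in-neighbours. -/
theorem GMP.utility_of_dominating (M : GMP N A) {a : A} (ha : ∀ a', a' ≠ a → M.lam a a')
    {π : N ≃ A} {z : N} (hz : π z = a) :
    M.utility π z = M.v z a + ∑ j ∈ Finset.univ.filter (fun j => M.tau j z), M.w j z := by
  unfold GMP.utility
  rw [hz]
  congr 1
  refine Finset.sum_congr (Finset.filter_congr fun j _ => ?_) fun _ _ => rfl
  refine and_iff_left_of_imp fun hj => M.lamSymm _ _ (ha _ fun h => ?_)
  have : j = z := π.injective (h.trans hz.symm)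
  exact M.noSelf z (this ▸ hj)

theorem GMP.utility_le_of_nonneg (M : GMP N A) (π : N ≃ A) {z : N}
    (hw : ∀ j, M.tau j z → 0 ≤ M.w j z) :
    M.utility π z ≤
      M.v z (π z) + ∑ j ∈ Finset.univ.filter (fun j => M.tau j z), M.w j z := by
  unfold GMP.utility
  refine add_le_add_right ?_ _
  refine Finset.sum_le_sum_of_subset_of_nonneg ?_ ?_
  · intro j
    simp only [Finset.mem_filter]
    tauto
  · intro j hj _
    exact hw j (Finset.mem_filter.1 hj).2

theorem Fin.sub_one_lt_of_ne_zero {n : ℕ} [NeZero n] {t : Fin n} (ht : t ≠ 0) : t - 1 < t := by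
  obtain _ | m := n
  · exact t.elim0
  · exact Fin.sub_one_lt_iff.2 (Fin.pos_iff_ne_zero.2 ht)

theorem swapAlloc_comm {P B : Type*} (π : P ≃ B) (i j : P) : swapAlloc π i j = swapAlloc π j i := by
  simp only [swapAlloc, Equiv.swap_comm]

theorem swapAlloc_apply_of_ne {P B : Type*} (π : P ≃ B) {i j k : P} (hi : k ≠ i) (hj : k ≠ j) :
    swapAlloc π i j k = π k := by
  simp [swapAlloc, Equiv.swap_apply_of_ne_of_ne hi hj]

/-- a GMP instance with uniform valuation whose player graph is the
directed cycle on `{1,…,n}` (the successor of `i` mod `n`) with at least one positive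
edge weight, and whose item graph has an item adjacent to every other item, admits a
2-stable allocation. -/
theorem stmt11 {A : Type*} [Fintype A] {n : ℕ} (hcard : Fintype.card A = n)
    (M : GMP (Fin n) A)
    (c : ℝ) (hc : 0 ≤ c) (hv : ∀ i a, M.v i a = c)
    (htau : ∀ i j : Fin n, M.tau i j ↔ j.val = (i.val + 1) % n)
    (hpos : ∃ i j : Fin n, M.tau j i ∧ 0 < M.w j i)
    (ha : ∃ a : A, ∀ a' : A, a' ≠ a → M.lam a a') :
    ∃ π : Fin n ≃ A, M.TwoStable π := by
  obtain ⟨z, p, hpz, hw⟩ := hpos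
  obtain ⟨a, ha⟩ := ha
  have : NeZero n := ⟨by rintro rfl; exact z.elim0⟩
  have hsucc : ∀ i j : Fin n, M.tau i j ↔ j = i + 1 := fun i j => by
    rw [htau, Fin.ext_iff (b := i + 1), Fin.val_add, Fin.val_one', Nat.add_mod_mod]
  have hnonneg : ∀ j, M.tau j z → 0 ≤ M.w j z := fun j hj => by
    have : j = p := add_right_cancel (((hsucc j z).1 hj).symm.trans ((hsucc p z).1 hpz))
    exact this ▸ hw.le
  -- Read the utilities along the cycle, starting from `z`, and maximize lexicographically.
  let f : (Fin n ≃ A) → Lex (Fin n → ℝ) := fun π => toLex fun t => M.utility π (z + t)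
  let S : Finset (Fin n ≃ A) := Finset.univ.filter fun π => π z = a
  have hS : S.Nonempty := by
    let e : Fin n ≃ A := (Fintype.equivFinOfCardEq hcard).symm
    exact ⟨(Equiv.swap z (e.symm a)).trans e, by simp [S]⟩
  obtain ⟨π, hπS, hmax⟩ := S.exists_max_image f hS
  have hπ : π z = a := (Finset.mem_filter.1 hπS).2
  have hzle : ∀ π' : Fin n ≃ A, M.utility π' z ≤ M.utility π z := fun π' => by
    rw [M.utility_of_dominating ha hπ, hv, ← hv z (π' z)]
    exact M.utility_le_of_nonneg π' hnonneg
  have key : ∀ i j : Fin n, i - z < j - z → ¬ M.BlockingPair π i j := by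
    rintro i j hlt ⟨-, hi, hj⟩
    have hiz : z ≠ i := by rintro rfl; exact (hzle _).not_gt hi
    have hjz : z ≠ j := by rintro rfl; exact (hzle _).not_gt hj
    have hπ' : swapAlloc π i j z = a := (swapAlloc_apply_of_ne π hiz hjz).trans hπ
    refine (hmax (swapAlloc π i j) (by simp [S, hπ'])).not_gt ?_
    refine ⟨i - z, fun t ht => ?_, ?_⟩
    · change M.utility π (z + t) = M.utility (swapAlloc π i j) (z + t)
      have hfix : ∀ s, s < i - z → swapAlloc π i j (z + s) = π (z + s) := fun s hs =>
        swapAlloc_apply_of_ne π (by rintro rfl; simp at hs)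
          (by rintro rfl; simp at hlt; exact lt_asymm hlt hs)
      rcases eq_or_ne t 0 with rfl | ht0
      · rw [add_zero, M.utility_of_dominating ha hπ, M.utility_of_dominating ha hπ']
      · refine (M.utility_congr (by rw [hv, hv]) (hfix t ht) fun k hk => ?_).symm
        have hk' : k = z + (t - 1) := by
          rw [← add_sub_assoc, (hsucc _ _).1 hk, add_sub_cancel_right]
        rw [hk']
        exact hfix _ ((Fin.sub_one_lt_of_ne_zero ht0).trans ht)
    · change M.utility π (z + (i - z)) < M.utility (swapAlloc π i j) (z + (i - z))
      rwa [add_sub_cancel]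
  refine ⟨π, fun i j hb => ?_⟩
  rcases lt_trichotomy (i - z) (j - z) with h | h | h
  · exact key i j h hb
  · exact hb.1 (sub_left_injective h)
  · exact key j i h ⟨hb.1.symm, swapAlloc_comm π i j ▸ hb.2.2, swapAlloc_comm π i j ▸ hb.2.1⟩
end

section
/- Let Q = (T, E) be a finite connected simple undirected graph with |T| = n vertices, and consider the GMP instance with item graph H = Q, players N = {1,...,n}, player graph the directed cycle in which each player i has the single in-neighbor i−1 (with 1−1 = n) and all edge weights equal to 1, and valuations v_i(a) = 0 for all i and a. Then every envy-free allocation π of this instance satisfies: for all i ∈ N, the items π(i−1) and π(i) are adjacent in Q. -/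
open scoped Classical

variable {N A : Type*} [Fintype N] [Fintype A]

/-- If `i` has `j` as its only in-neighbour, the edge weight is `1` and valuations vanish, then
the utility of `i` indicates whether the items of `j` and `i` are adjacent. -/
lemma GMP.utility_eq_ite_of_unique_inNeighbor {N A : Type*} [Fintype N] [Fintype A]
    (M : GMP N A) {j i : N} (htau : ∀ k, M.tau k i ↔ k = j) (hw : M.w j i = 1)
    (hv : ∀ a, M.v i a = 0) (π : N ≃ A) :
    M.utility π i = if M.lam (π j) (π i) then 1 else 0 := by
  simp only [GMP.utility, hv, zero_add, htau]
  rw [Finset.sum_filter, Finset.sum_eq_single j]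
  · simp [hw]
  · intro k _ hk
    simp [hk]
  · simp

lemma swapAlloc_apply_left {N A : Type*} (π : N ≃ A) (i j : N) :
    swapAlloc π i j i = π j := by
  simp [swapAlloc]

lemma swapAlloc_apply_of_ne_of_ne {N A : Type*} (π : N ≃ A) {i j k : N}
    (hi : k ≠ i) (hj : k ≠ j) : swapAlloc π i j k = π k := by
  simp [swapAlloc, Equiv.swap_apply_of_ne_of_ne hi hj]

/-- The successor map of the directed cycle on `Fin n` is injective. -/
lemma Fin.eq_of_succ_mod_eq {n : ℕ} {j k : Fin n}
    (h : (j.val + 1) % n = (k.val + 1) % n) : j = k := by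
  have h' : j.val ≡ k.val [MOD n] := Nat.ModEq.add_right_cancel' 1 h
  exact Fin.ext (h'.eq_of_lt_of_lt j.isLt k.isLt)

/-- for the GMP instance built from a connected graph `Q` (item graph
`Q`, players on a directed cycle where the in-neighbour of `i` is `i − 1`, unit
weights, zero valuations), every envy-free allocation places adjacent items on
consecutive players: `π(i−1)` is adjacent to `π(i)` in `Q` for every `i`. -/
theorem stmt15 {T : Type*} [Fintype T] (Q : SimpleGraph T) (hconn : Q.Connected)
    (M : GMP (Fin (Fintype.card T)) T)
    (htau : ∀ j i : Fin (Fintype.card T),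
      M.tau j i ↔ i.val = (j.val + 1) % Fintype.card T)
    (hw : ∀ j i : Fin (Fintype.card T), M.tau j i → M.w j i = 1)
    (hv : ∀ i a, M.v i a = 0)
    (hlam : ∀ a b : T, M.lam a b ↔ Q.Adj a b)
    (π : Fin (Fintype.card T) ≃ T) (hEF : M.EnvyFree π) :
    ∀ j i : Fin (Fintype.card T), i.val = (j.val + 1) % Fintype.card T →
      Q.Adj (π j) (π i) := by
  intro j i hji
  by_contra hadj
  have htau' : ∀ k, M.tau k i ↔ k = j := fun k => by
    rw [htau]
    refine ⟨fun hk => Fin.eq_of_succ_mod_eq (hk.symm.trans hji), ?_⟩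
    rintro rfl
    exact hji
  have hutil := M.utility_eq_ite_of_unique_inNeighbor htau' (hw j i ((htau j i).2 hji)) (hv i)
  have hne : j ≠ i := by
    rintro rfl
    exact M.noSelf j ((htau j j).2 hji)
  have : Nontrivial T := ⟨π j, π i, π.injective.ne hne⟩
  obtain ⟨b, hb⟩ := hconn.preconnected.exists_adj_of_nontrivial (π j)
  have hjb : j ≠ π.symm b := by
    rintro h
    rw [h, Equiv.apply_symm_apply] at hb
    exact Q.irrefl hb
  apply hEF i (π.symm b)
  rw [hutil, hutil]
  simp [swapAlloc_apply_left, swapAlloc_apply_of_ne_of_ne π hne hjb, hlam, hadj, hb]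
end
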